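/- Let c be a unit quaternion with c ≠ 1 and c ≠ −1, let C = {x ∈ S³ : x is conjugate to c} be its conjugacy class, and let Xₙ(C) = {(g₀,…,gₙ) ∈ (S³)^{n+1} : g₀²⋯gₙ² ∈ C}. Let S³ act on Xₙ(C) by componentwise conjugation q•(g₀,…,gₙ) = (qg₀q⁻¹,…,qgₙq⁻¹), and on C × Xₙ^r by q•(x, h) = (qxq⁻¹, q•h) (conjugation on C and componentwise conjugation on Xₙ^r). Then there exists an S³-equivariant homeomorphism e : Xₙ(C) → C × Xₙ^r, i.e., a homeomorphism with e(q•g) = q•e(g) for all q ∈ S³ and g ∈ Xₙ(C). -/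

import Mathlib

noncomputable section

/-- `S³`, the group of unit quaternions. -/
abbrev S3 : Type := Metric.sphere (0 : Quaternion ℝ) 1

/-- The map `□ₙ : (S³)^{n+1} → S³`, `(g₀,…,gₙ) ↦ g₀²g₁²⋯gₙ²` (ordered product). -/
def box (n : ℕ) (g : Fin (n + 1) → S3) : S3 :=
  ((List.finRange (n + 1)).map fun i => (g i) ^ 2).prod

/-- The fibre `Xₙ(ε) = □ₙ⁻¹(ε)`, with the subspace topology. -/
abbrev X (n : ℕ) (ε : S3) : Type := {g : Fin (n + 1) → S3 // box n g = ε}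

/-- The conjugacy class of `c` in `S³`. -/
def conjClass (c : S3) : Set S3 := {x | ∃ q : S3, x = q * c * q⁻¹}

/-- `Xₙ(C) = {g ∈ (S³)^{n+1} : □ₙ(g) ∈ C}` for the conjugacy class `C` of `c`. -/
abbrev XC (n : ℕ) (c : S3) : Type := {g : Fin (n + 1) → S3 // box n g ∈ conjClass c}

open scoped ComplexConjugate

/-- The common angular frequency of the orbit through `(r, b)`. -/
def angFreq (r b : ℝ) : ℝ := √(r ^ 2 * (1 - r ^ 2 - b ^ 2))

/-- The cosine-like fundamental solution of `f'' = -(angFreq r b)² f`. -/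
def cosT (r b s : ℝ) : ℝ := Real.cos (angFreq r b * s)

/-- The sine-like fundamental solution of `f'' = -(angFreq r b)² f`. -/
def sinT (r b s : ℝ) : ℝ := s * Real.sinc (angFreq r b * s)

/-- The multiplier governing the squaring flow: the flow rotates the square of the point with
real part `r` and axial part `b` by twice the argument of `eta r b s`. -/
def eta (r b s : ℝ) : ℂ := ⟨cosT r b s + sinT r b s * (r * b), sinT r b s * r ^ 2⟩

lemma angFreq_sq {r b : ℝ} (h : r ^ 2 + b ^ 2 ≤ 1) :
    angFreq r b ^ 2 = r ^ 2 * (1 - r ^ 2 - b ^ 2) :=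
  Real.sq_sqrt (mul_nonneg (sq_nonneg r) (by linarith))

lemma angFreq_mul_sinT (r b s : ℝ) : angFreq r b * sinT r b s = Real.sin (angFreq r b * s) := by
  unfold sinT
  by_cases h : angFreq r b * s = 0
  · rcases mul_eq_zero.mp h with h' | h' <;> simp [h']
  · rw [Real.sinc_of_ne_zero h, ← mul_assoc, mul_div_cancel₀ _ h]

lemma cosT_sq_add {r b : ℝ} (h : r ^ 2 + b ^ 2 ≤ 1) (s : ℝ) :
    cosT r b s ^ 2 + r ^ 2 * (1 - r ^ 2 - b ^ 2) * sinT r b s ^ 2 = 1 := by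
  rw [← angFreq_sq h, ← mul_pow, angFreq_mul_sinT]
  exact Real.cos_sq_add_sin_sq _

lemma hasDerivAt_cosT {r b : ℝ} (h : r ^ 2 + b ^ 2 ≤ 1) (s : ℝ) :
    HasDerivAt (cosT r b) (-(r ^ 2 * (1 - r ^ 2 - b ^ 2) * sinT r b s)) s := by
  refine (((hasDerivAt_id s).const_mul (angFreq r b)).cos).congr_deriv ?_
  simp only [id]
  rw [← angFreq_mul_sinT, ← angFreq_sq h]
  ring

lemma hasDerivAt_sinT (r b s : ℝ) : HasDerivAt (sinT r b) (cosT r b s) s := by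
  by_cases h : angFreq r b = 0
  · have e : sinT r b = id := by funext t; simp [sinT, h]
    rw [e]
    simpa [cosT, h] using hasDerivAt_id s
  · have e : sinT r b = fun t => Real.sin (angFreq r b * t) / angFreq r b := by
      funext t
      rw [← angFreq_mul_sinT]
      field_simp
    rw [e]
    refine
      ((((hasDerivAt_id s).const_mul (angFreq r b)).sin).div_const (angFreq r b)).congr_deriv ?_
    simp only [id, cosT]
    field_simp

lemma cosT_add {r b : ℝ} (h : r ^ 2 + b ^ 2 ≤ 1) (s t : ℝ) :
    cosT r b (s + t) = cosT r b s * cosT r b t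
      - r ^ 2 * (1 - r ^ 2 - b ^ 2) * (sinT r b s * sinT r b t) := by
  have h1 := angFreq_mul_sinT r b s
  have h2 := angFreq_mul_sinT r b t
  rw [← angFreq_sq h]
  unfold cosT
  rw [mul_add, Real.cos_add, ← h1, ← h2]
  ring

lemma sinT_add (r b s t : ℝ) :
    sinT r b (s + t) = sinT r b s * cosT r b t + cosT r b s * sinT r b t := by
  by_cases h : angFreq r b = 0
  · simp [sinT, cosT, h]
  · have h1 := angFreq_mul_sinT r b s
    have h2 := angFreq_mul_sinT r b t
    have h3 := angFreq_mul_sinT r b (s + t)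
    rw [mul_add, Real.sin_add, ← h1, ← h2] at h3
    apply mul_left_cancel₀ h
    rw [h3]
    unfold cosT
    ring

lemma continuous_cosT : Continuous fun p : ℝ × ℝ × ℝ => cosT p.1 p.2.1 p.2.2 := by
  unfold cosT angFreq
  fun_prop

lemma continuous_sinT : Continuous fun p : ℝ × ℝ × ℝ => sinT p.1 p.2.1 p.2.2 := by
  unfold sinT angFreq
  fun_prop

lemma continuous_eta : Continuous fun p : ℝ × ℝ × ℝ => eta p.1 p.2.1 p.2.2 := by
  have h1 := continuous_cosT
  have h2 := continuous_sinT
  have e : (fun p : ℝ × ℝ × ℝ => eta p.1 p.2.1 p.2.2) = fun p =>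
      ((cosT p.1 p.2.1 p.2.2 + sinT p.1 p.2.1 p.2.2 * (p.1 * p.2.1) : ℝ) : ℂ)
        + ((sinT p.1 p.2.1 p.2.2 * p.1 ^ 2 : ℝ) : ℂ) * Complex.I := by
    funext p
    apply Complex.ext <;> simp [eta, -Complex.ofReal_pow, -Complex.ofReal_mul]
  rw [e]
  fun_prop

lemma eta_zero (r b : ℝ) : eta r b 0 = 1 := by
  apply Complex.ext <;> simp [eta, cosT, sinT]

lemma sq_norm_eta (r b s : ℝ) :
    ‖eta r b s‖ ^ 2 = (cosT r b s + sinT r b s * (r * b)) ^ 2 + (sinT r b s * r ^ 2) ^ 2 := by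
  rw [Complex.sq_norm, Complex.normSq_apply]
  simp only [eta]
  ring

lemma eta_ne_zero {r b : ℝ} (h : r ^ 2 + b ^ 2 ≤ 1) (s : ℝ) : eta r b s ≠ 0 := by
  intro h0
  have hc := cosT_sq_add h s
  have h1 : cosT r b s + sinT r b s * (r * b) = 0 := congrArg Complex.re h0
  have h2 : sinT r b s * r ^ 2 = 0 := congrArg Complex.im h0
  have h3 : sinT r b s * r = 0 := by
    rcases mul_eq_zero.mp h2 with h' | h'
    · simp [h']
    · simp [pow_eq_zero_iff (two_ne_zero) |>.mp h']
  have h4 : cosT r b s = 0 := by linear_combination h1 - b * h3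
  have : (1 : ℝ) = 0 := by
    linear_combination (cosT r b s) * h4 + (1 - r ^ 2 - b ^ 2) * (sinT r b s * r) * h3 - hc
  exact one_ne_zero this

lemma norm_eta_pos {r b : ℝ} (h : r ^ 2 + b ^ 2 ≤ 1) (s : ℝ) : 0 < ‖eta r b s‖ :=
  norm_pos_iff.mpr (eta_ne_zero h s)

/-- The axial coordinate, multiplied by `‖eta r b s‖`, of the point with initial
coordinates `(r, b)` after time `s`. -/
def axialNum (r b s : ℝ) : ℝ :=
  cosT r b s ^ 2 * b - cosT r b s * sinT r b s * r * (1 - r ^ 2 - b ^ 2)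
    + cosT r b s * sinT r b s * r * b ^ 2 - sinT r b s ^ 2 * r ^ 2 * b * (1 - r ^ 2 - b ^ 2)
    + sinT r b s * r ^ 3 * cosT r b s

lemma disc_identity {r b : ℝ} (h : r ^ 2 + b ^ 2 ≤ 1) (s : ℝ) :
    ‖eta r b s‖ ^ 2 - r ^ 2 - axialNum r b s ^ 2
      = (‖eta r b s‖ ^ 2) ^ 2 * (1 - r ^ 2 - b ^ 2) := by
  have hc := cosT_sq_add h s
  rw [sq_norm_eta]
  unfold axialNum
  linear_combination (r ^ 2 * (cosT r b s ^ 2 + r ^ 2 * (1 - r ^ 2 - b ^ 2) * sinT r b s ^ 2 + 1)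
    - ((cosT r b s + sinT r b s * (r * b)) ^ 2 + (sinT r b s * r ^ 2) ^ 2)) * hc

lemma disc_next {r b : ℝ} (h : r ^ 2 + b ^ 2 ≤ 1) (s : ℝ) :
    1 - (r / ‖eta r b s‖) ^ 2 - (axialNum r b s / ‖eta r b s‖) ^ 2
      = ‖eta r b s‖ ^ 2 * (1 - r ^ 2 - b ^ 2) := by
  have hN := (norm_eta_pos h s).ne'
  have := disc_identity h s
  field_simp
  linear_combination this

lemma angFreq_next {r b : ℝ} (h : r ^ 2 + b ^ 2 ≤ 1) (s : ℝ) :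
    angFreq (r / ‖eta r b s‖) (axialNum r b s / ‖eta r b s‖) = angFreq r b := by
  have hN := (norm_eta_pos h s).ne'
  unfold angFreq
  rw [disc_next h s]
  congr 1
  field_simp

lemma eta_add {r b : ℝ} (h : r ^ 2 + b ^ 2 ≤ 1) (s t : ℝ) :
    eta r b (s + t) =
      eta r b s * eta (r / ‖eta r b s‖) (axialNum r b s / ‖eta r b s‖) t := by
  have hN := (norm_eta_pos h s).ne'
  have hN2 := sq_norm_eta r b s
  have hc := cosT_sq_add h s
  have hC : cosT (r / ‖eta r b s‖) (axialNum r b s / ‖eta r b s‖) t = cosT r b t := by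
    unfold cosT; rw [angFreq_next h]
  have hS : sinT (r / ‖eta r b s‖) (axialNum r b s / ‖eta r b s‖) t = sinT r b t := by
    unfold sinT; rw [angFreq_next h]
  have e1 : r / ‖eta r b s‖ * (axialNum r b s / ‖eta r b s‖)
      = r * axialNum r b s / ‖eta r b s‖ ^ 2 := by field_simp
  have hr : r = (cosT r b s + sinT r b s * (r * b)) * (cosT r b s * r)
      - (sinT r b s * r ^ 2) * (cosT r b s * b - r * (1 - r ^ 2 - b ^ 2) * sinT r b s) := by
    linear_combination -r * hc
  have ha : axialNum r b s = (cosT r b s + sinT r b s * (r * b)) *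
      (cosT r b s * b - r * (1 - r ^ 2 - b ^ 2) * sinT r b s)
      + (sinT r b s * r ^ 2) * (cosT r b s * r) := by
    unfold axialNum
    ring
  have k1 : (cosT r b s + sinT r b s * (r * b)) * axialNum r b s - (sinT r b s * r ^ 2) * r
      = ‖eta r b s‖ ^ 2 * (cosT r b s * b - r * (1 - r ^ 2 - b ^ 2) * sinT r b s) := by
    rw [hN2]
    linear_combination (cosT r b s + sinT r b s * (r * b)) * ha - (sinT r b s * r ^ 2) * hr
  have k2 : (sinT r b s * r ^ 2) * axialNum r b s + (cosT r b s + sinT r b s * (r * b)) * r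
      = ‖eta r b s‖ ^ 2 * (cosT r b s * r) := by
    rw [hN2]
    linear_combination (sinT r b s * r ^ 2) * ha + (cosT r b s + sinT r b s * (r * b)) * hr
  set N := ‖eta r b s‖
  apply Complex.ext
  · simp only [eta, Complex.mul_re]
    rw [hC, hS, e1, div_pow, cosT_add h, sinT_add]
    field_simp
    linear_combination -(r * sinT r b t) * k1
  · simp only [eta, Complex.mul_im]
    rw [hC, hS, e1, div_pow, sinT_add]
    field_simp
    linear_combination -(r * sinT r b t) * k2

lemma hasDerivAt_eta {r b : ℝ} (h : r ^ 2 + b ^ 2 ≤ 1) (s : ℝ) :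
    HasDerivAt (eta r b) (⟨-(r ^ 2 * (1 - r ^ 2 - b ^ 2) * sinT r b s) + cosT r b s * (r * b),
      cosT r b s * r ^ 2⟩ : ℂ) s := by
  have h1 := ((hasDerivAt_cosT h s).add ((hasDerivAt_sinT r b s).mul_const (r * b))).ofReal_comp
  have h2 := (((hasDerivAt_sinT r b s).mul_const (r ^ 2)).ofReal_comp).mul_const Complex.I
  have e : eta r b = fun t => ((cosT r b t + sinT r b t * (r * b) : ℝ) : ℂ)
      + ((sinT r b t * r ^ 2 : ℝ) : ℂ) * Complex.I := by
    funext t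
    apply Complex.ext <;> simp [eta, -Complex.ofReal_pow, -Complex.ofReal_mul]
  rw [e]
  refine (h1.add h2).congr_deriv ?_
  apply Complex.ext <;> simp [-Complex.ofReal_pow, -Complex.ofReal_mul]

/-- The argument of `eta r b s` is any primitive of `(r / ‖eta r b s‖)²` vanishing at zero. -/
lemma eta_eq_exp_mul_conj {r b : ℝ} (h : r ^ 2 + b ^ 2 ≤ 1) {θ : ℝ → ℝ} (h0 : θ 0 = 0)
    (hθ : ∀ s, HasDerivAt θ ((r / ‖eta r b s‖) ^ 2) s) (s : ℝ) :
    eta r b s = Complex.exp (2 * θ s * Complex.I) * conj (eta r b s) := by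
  have hne : ∀ t, conj (eta r b t) ≠ 0 := fun t => by simpa using eta_ne_zero h t
  have key : ∀ t, HasDerivAt
      (fun t => eta r b t * Complex.exp (-(2 * θ t * Complex.I)) / conj (eta r b t)) 0 t := by
    intro t
    have d1 := hasDerivAt_eta h t
    have d2 : HasDerivAt (fun t => Complex.exp (-(2 * θ t * Complex.I))) _ t :=
      ((((hθ t).ofReal_comp).const_mul (2 : ℂ)).mul_const Complex.I).neg.cexp
    have d3 : HasDerivAt (fun t => conj (eta r b t)) _ t := d1.star
    refine ((d1.mul d2).div d3 (hne t)).congr_deriv ?_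
    have hN : ‖eta r b t‖ ≠ 0 := (norm_eta_pos h t).ne'
    have hθ' : (r / ‖eta r b t‖) ^ 2 * ‖eta r b t‖ ^ 2 = r ^ 2 := by field_simp
    have hθ2 : (((r / ‖eta r b t‖) ^ 2 : ℝ) : ℂ) * (eta r b t * conj (eta r b t))
        = ((r ^ 2 : ℝ) : ℂ) := by
      rw [Complex.mul_conj, Complex.normSq_eq_norm_sq, ← Complex.ofReal_mul, hθ']
    have hI : (⟨-(r ^ 2 * (1 - r ^ 2 - b ^ 2) * sinT r b t) + cosT r b t * (r * b),
        cosT r b t * r ^ 2⟩ : ℂ) * conj (eta r b t) - eta r b t *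
          star (⟨-(r ^ 2 * (1 - r ^ 2 - b ^ 2) * sinT r b t) + cosT r b t * (r * b),
            cosT r b t * r ^ 2⟩ : ℂ) = 2 * ((r ^ 2 : ℝ) : ℂ) * Complex.I := by
      have hc := cosT_sq_add h t
      apply Complex.ext
      · simp [eta, -Complex.ofReal_pow]
        ring
      · simp [eta, -Complex.ofReal_pow]
        linear_combination 2 * r ^ 2 * hc
    simp only [Pi.mul_apply, Pi.neg_apply]
    rw [div_eq_zero_iff]
    left
    linear_combination Complex.exp (-(2 * θ t * Complex.I)) * hI
      - 2 * Complex.I * Complex.exp (-(2 * θ t * Complex.I)) * hθ2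
  have hc := is_const_of_deriv_eq_zero (fun t => (key t).differentiableAt)
    (fun t => (key t).deriv) s 0
  simp only [h0, eta_zero] at hc
  rw [div_eq_iff (hne s)] at hc
  simp only [Complex.ofReal_zero, mul_zero, zero_mul, neg_zero, Complex.exp_zero, map_one,
    div_one, one_mul, mul_one] at hc
  rw [← hc, Complex.exp_neg]
  field_simp [Complex.exp_ne_zero]

/-- The sphere of purely imaginary unit quaternions. -/
abbrev PureS3 : Type := {w : S3 // (w : Quaternion ℝ).re = 0}

lemma sum_sq_eq_one (g : S3) : (g : Quaternion ℝ).re ^ 2 + (g : Quaternion ℝ).imI ^ 2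
    + (g : Quaternion ℝ).imJ ^ 2 + (g : Quaternion ℝ).imK ^ 2 = 1 := by
  rw [← Quaternion.normSq_def', Quaternion.normSq_eq_norm_mul_self, norm_eq_of_mem_sphere, one_mul]

lemma re_mul_comm (a b : Quaternion ℝ) : (a * b).re = (b * a).re := by
  simp only [Quaternion.re_mul]
  ring

lemma coe_mul_self_eq (g : S3) :
    (g : Quaternion ℝ) * g = ((2 * (g : Quaternion ℝ).re : ℝ) : Quaternion ℝ) * g - 1 := by
  have := sum_sq_eq_one g
  have h0 : (1 : Quaternion ℝ).re = 1 := rfl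
  have h1 : (1 : Quaternion ℝ).imI = 0 := rfl
  have h2 : (1 : Quaternion ℝ).imJ = 0 := rfl
  have h3 : (1 : Quaternion ℝ).imK = 0 := rfl
  apply Quaternion.ext
  · simp [h0]
    linear_combination -this
  · simp [h1]
    ring
  · simp [h2]
    ring
  · simp [h3]
    ring

lemma pure_mul_self (w : PureS3) : ((w : S3) : Quaternion ℝ) * (w : S3) = -1 := by
  rw [coe_mul_self_eq, w.2]
  simp

/-- The embedding `ℂ → ℍ` sending `i` to the imaginary unit `w`. -/
def planeEmb (w : PureS3) : ℂ →ₐ[ℝ] Quaternion ℝ :=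
  Complex.liftAux ((w : S3) : Quaternion ℝ) (pure_mul_self w)

lemma planeEmb_apply (w : PureS3) (z : ℂ) :
    planeEmb w z = (z.re : Quaternion ℝ) + z.im • ((w : S3) : Quaternion ℝ) := rfl

lemma planeEmb_ofReal (w : PureS3) (x : ℝ) : planeEmb w (x : ℂ) = (x : Quaternion ℝ) := by
  simp

lemma planeEmb_I (w : PureS3) : planeEmb w Complex.I = ((w : S3) : Quaternion ℝ) := by
  simp [planeEmb]

lemma re_planeEmb (w : PureS3) (z : ℂ) : (planeEmb w z).re = z.re := by
  simp [planeEmb_apply, w.2]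

lemma star_planeEmb (w : PureS3) (z : ℂ) : star (planeEmb w z) = planeEmb w (conj z) := by
  ext <;> simp [planeEmb_apply, w.2]

lemma normSq_planeEmb (w : PureS3) (z : ℂ) :
    Quaternion.normSq (planeEmb w z) = ‖z‖ ^ 2 := by
  rw [Quaternion.normSq_def, star_planeEmb, ← map_mul, re_planeEmb, Complex.mul_conj,
    Complex.ofReal_re, Complex.normSq_eq_norm_sq]

lemma continuous_planeEmb : Continuous fun p : PureS3 × ℂ => planeEmb p.1 p.2 := by
  simp only [planeEmb_apply]
  have := Quaternion.continuous_coe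
  fun_prop

/-- The component of `g` in the direction `w`. -/
def axial (w : PureS3) (g : S3) : ℝ := -(((w : S3) : Quaternion ℝ) * g).re

lemma re_sq_add_axial_sq_le (w : PureS3) (g : S3) :
    (g : Quaternion ℝ).re ^ 2 + axial w g ^ 2 ≤ 1 := by
  have h1 := sum_sq_eq_one g
  have h2 := sum_sq_eq_one (w : S3)
  have h3 := w.2
  unfold axial
  rw [Quaternion.re_mul, h3]
  rw [h3] at h2
  generalize ((w : S3) : Quaternion ℝ).imI = a at *
  generalize ((w : S3) : Quaternion ℝ).imJ = b at *
  generalize ((w : S3) : Quaternion ℝ).imK = c at *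
  generalize (g : Quaternion ℝ).re = r at *
  generalize (g : Quaternion ℝ).imI = x at *
  generalize (g : Quaternion ℝ).imJ = y at *
  generalize (g : Quaternion ℝ).imK = z at *
  have e : 1 - (r ^ 2 + (-(0 * r - a * x - b * y - c * z)) ^ 2)
      = (a * y - b * x) ^ 2 + (a * z - c * x) ^ 2 + (b * z - c * y) ^ 2 := by
    linear_combination -h1 - (x ^ 2 + y ^ 2 + z ^ 2) * h2
  have := add_nonneg (add_nonneg (sq_nonneg (a * y - b * x)) (sq_nonneg (a * z - c * x)))
    (sq_nonneg (b * z - c * y))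
  linarith

lemma re_planeEmb_mul (w : PureS3) (z : ℂ) (g : S3) :
    (planeEmb w z * g).re = z.re * (g : Quaternion ℝ).re - z.im * axial w g := by
  rw [planeEmb_apply, add_mul, Quaternion.re_add, smul_mul_assoc, Quaternion.re_smul, axial]
  simp
  ring

lemma normSq_planeEmb_mul_sub (w : PureS3) (z z' : ℂ) (g : S3) :
    Quaternion.normSq (planeEmb w z * (g : Quaternion ℝ) - planeEmb w z') = ‖z‖ ^ 2 + ‖z'‖ ^ 2
      - 2 * ((conj z' * z).re * (g : Quaternion ℝ).re - (conj z' * z).im * axial w g) := by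
  have hg : Quaternion.normSq (g : Quaternion ℝ) = 1 := by
    rw [Quaternion.normSq_eq_norm_mul_self, norm_eq_of_mem_sphere, one_mul]
  rw [← re_planeEmb_mul, map_mul (planeEmb w), ← star_planeEmb, mul_assoc, re_mul_comm (star _)]
  have e : ∀ x y : Quaternion ℝ, Quaternion.normSq (x - y)
      = Quaternion.normSq x + Quaternion.normSq y - 2 * (x * star y).re := by
    intro x y
    simp only [Quaternion.normSq_def', Quaternion.re_mul, Quaternion.re_sub, Quaternion.imI_sub,
      Quaternion.imJ_sub, Quaternion.imK_sub, Quaternion.re_star, Quaternion.imI_star,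
      Quaternion.imJ_star, Quaternion.imK_star]
    ring
  rw [e, map_mul, hg, normSq_planeEmb, normSq_planeEmb, mul_one]

/-- The multiplier of the squaring flow about the axis `w` at `g` and time `s`. -/
def mult (w : PureS3) (s : ℝ) (g : S3) : ℂ := eta (g : Quaternion ℝ).re (axial w g) s

/-- The product of the real part of `g` and the sine-like function of its orbit. -/
def shift (w : PureS3) (s : ℝ) (g : S3) : ℝ :=
  (g : Quaternion ℝ).re * sinT (g : Quaternion ℝ).re (axial w g) s

lemma mult_ne_zero (w : PureS3) (s : ℝ) (g : S3) : mult w s g ≠ 0 :=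
  eta_ne_zero (re_sq_add_axial_sq_le w g) s

lemma norm_mult_pos (w : PureS3) (s : ℝ) (g : S3) : 0 < ‖mult w s g‖ :=
  norm_pos_iff.mpr (mult_ne_zero w s g)

lemma mult_zero (w : PureS3) (g : S3) : mult w 0 g = 1 := eta_zero _ _

lemma shift_zero (w : PureS3) (g : S3) : shift w 0 g = 0 := by simp [shift, sinT]

/-- The underlying quaternion of `sqFlow`. -/
def sqFlowVal (w : PureS3) (s : ℝ) (g : S3) : Quaternion ℝ :=
  planeEmb w (mult w s g ^ 2 / ‖mult w s g‖) * g
    - planeEmb w (mult w s g * shift w s g * Complex.I / ‖mult w s g‖)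

lemma normSq_sqFlowVal (w : PureS3) (s : ℝ) (g : S3) :
    Quaternion.normSq (sqFlowVal w s g) = 1 := by
  have hN := (norm_mult_pos w s g).ne'
  have hd := re_sq_add_axial_sq_le w g
  have hc := cosT_sq_add hd s
  have hNC : ((‖mult w s g‖ : ℝ) : ℂ) ≠ 0 := by exact_mod_cast hN
  have hconj : mult w s g * conj (mult w s g) = ((‖mult w s g‖ : ℝ) : ℂ) ^ 2 := by
    rw [Complex.mul_conj, Complex.normSq_eq_norm_sq]
    push_cast
    rfl
  have e : conj (mult w s g * shift w s g * Complex.I / ‖mult w s g‖)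
      * (mult w s g ^ 2 / ‖mult w s g‖) = -(mult w s g * shift w s g * Complex.I) := by
    simp only [map_div₀, map_mul, Complex.conj_ofReal, Complex.conj_I]
    field_simp
    linear_combination -(mult w s g * shift w s g) * hconj
  have n1 : ‖mult w s g ^ 2 / ‖mult w s g‖‖ = ‖mult w s g‖ := by
    rw [norm_div, norm_pow, Complex.norm_real, norm_norm]
    field_simp
  have n2 : ‖mult w s g * shift w s g * Complex.I / ‖mult w s g‖‖ ^ 2 = shift w s g ^ 2 := by
    rw [norm_div, norm_mul, norm_mul, Complex.norm_real, Complex.norm_real, norm_norm,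
      Complex.norm_I, mul_one, mul_div_cancel_left₀ _ hN, Real.norm_eq_abs, sq_abs]
  rw [sqFlowVal, normSq_planeEmb_mul_sub, e, n1, n2]
  have hsq := sq_norm_eta (g : Quaternion ℝ).re (axial w g) s
  have hre : (mult w s g).re = cosT (g : Quaternion ℝ).re (axial w g) s
    + sinT (g : Quaternion ℝ).re (axial w g) s * ((g : Quaternion ℝ).re * axial w g) := rfl
  have him : (mult w s g).im = sinT (g : Quaternion ℝ).re (axial w g) s
    * (g : Quaternion ℝ).re ^ 2 := rfl
  change ‖mult w s g‖ ^ 2 = _ at hsq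
  simp only [Complex.neg_re, Complex.neg_im, Complex.mul_re, Complex.mul_im, Complex.ofReal_re,
    Complex.ofReal_im, Complex.I_re, Complex.I_im, hre, him, hsq, shift]
  linear_combination hc

/-- The squaring flow about the axis `w`: a flow on `S³` along which the square of a point
rotates by left multiplication with the circle through `w`. -/
def sqFlow (w : PureS3) (s : ℝ) (g : S3) : S3 :=
  ⟨sqFlowVal w s g, by
    rw [mem_sphere_zero_iff_norm, ← sq_eq_sq₀ (norm_nonneg _) zero_le_one, sq,
      ← Quaternion.normSq_eq_norm_mul_self, normSq_sqFlowVal, one_pow]⟩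

lemma coe_sqFlow (w : PureS3) (s : ℝ) (g : S3) :
    (sqFlow w s g : Quaternion ℝ) = planeEmb w (mult w s g ^ 2 / ‖mult w s g‖) * g
      - planeEmb w (mult w s g * shift w s g * Complex.I / ‖mult w s g‖) := rfl

lemma re_sqFlow (w : PureS3) (s : ℝ) (g : S3) :
    (sqFlow w s g : Quaternion ℝ).re = (g : Quaternion ℝ).re / ‖mult w s g‖ := by
  have hN := (norm_mult_pos w s g).ne'
  have hc := cosT_sq_add (re_sq_add_axial_sq_le w g) s
  rw [coe_sqFlow, Quaternion.re_sub, re_planeEmb_mul, re_planeEmb]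
  simp only [Complex.div_ofReal_re, Complex.div_ofReal_im]
  field_simp
  simp only [sq, Complex.mul_re, Complex.mul_im, Complex.ofReal_re, Complex.ofReal_im,
    Complex.I_re, Complex.I_im, shift, mult, eta]
  linear_combination (g : Quaternion ℝ).re * hc

lemma axial_sqFlow (w : PureS3) (s : ℝ) (g : S3) :
    axial w (sqFlow w s g)
      = axialNum (g : Quaternion ℝ).re (axial w g) s / ‖mult w s g‖ := by
  have hN := (norm_mult_pos w s g).ne'
  rw [axial, coe_sqFlow, ← planeEmb_I w, mul_sub, ← mul_assoc, ← map_mul, ← map_mul,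
    Quaternion.re_sub, re_planeEmb_mul, re_planeEmb]
  simp only [Complex.mul_re, Complex.mul_im, Complex.I_re, Complex.I_im, Complex.div_ofReal_re,
    Complex.div_ofReal_im]
  field_simp
  simp only [sq, Complex.mul_re, Complex.mul_im, Complex.ofReal_re, Complex.ofReal_im,
    shift, mult, eta, axialNum]
  ring

lemma mult_add (w : PureS3) (s t : ℝ) (g : S3) :
    mult w (s + t) g = mult w s g * mult w t (sqFlow w s g) := by
  rw [mult, eta_add (re_sq_add_axial_sq_le w g)]
  unfold mult
  rw [re_sqFlow, axial_sqFlow]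
  rfl

lemma shift_sqFlow (w : PureS3) (s t : ℝ) (g : S3) :
    shift w t (sqFlow w s g) = (g : Quaternion ℝ).re / ‖mult w s g‖
      * sinT (g : Quaternion ℝ).re (axial w g) t := by
  rw [shift, re_sqFlow, axial_sqFlow]
  congr 1
  unfold sinT mult
  rw [angFreq_next (re_sq_add_axial_sq_le w g)]

lemma sqFlow_add (w : PureS3) (s t : ℝ) (g : S3) :
    sqFlow w (s + t) g = sqFlow w t (sqFlow w s g) := by
  apply Subtype.ext
  rw [coe_sqFlow w t, coe_sqFlow w s, coe_sqFlow, mul_sub,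
    ← mul_assoc (planeEmb w _) (planeEmb w _) (g : Quaternion ℝ), ← map_mul, ← map_mul,
    sub_sub, ← map_add, mult_add, norm_mul, shift_sqFlow]
  have hd := re_sq_add_axial_sq_le w g
  have h1 : ((‖mult w s g‖ : ℝ) : ℂ) ≠ 0 := by exact_mod_cast (norm_mult_pos w s g).ne'
  have h2 : ((‖mult w t (sqFlow w s g)‖ : ℝ) : ℂ) ≠ 0 := by
    exact_mod_cast (norm_mult_pos w t (sqFlow w s g)).ne'
  congr 2
  · congr 1
    push_cast
    field_simp
  · push_cast
    have key : mult w s g * (shift w (s + t) g : ℂ) = mult w s g * mult w t (sqFlow w s g)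
        * shift w s g + ((g : Quaternion ℝ).re * sinT (g : Quaternion ℝ).re (axial w g) t : ℝ) := by
      rw [← mult_add]
      have hC := cosT_sq_add hd s
      have hS := sinT_add (g : Quaternion ℝ).re (axial w g) s t
      have hA := cosT_add hd s t
      apply Complex.ext
      · simp only [mult, shift, eta, Complex.mul_re, Complex.add_re, Complex.ofReal_re,
          Complex.ofReal_im, hS, hA]
        linear_combination ((g : Quaternion ℝ).re *
          sinT (g : Quaternion ℝ).re (axial w g) t) * hC
      · simp only [mult, shift, eta, Complex.mul_im, Complex.add_im, Complex.ofReal_re,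
          Complex.ofReal_im, hS, hA]
        ring
    push_cast at key
    field_simp
    linear_combination (mult w t (sqFlow w s g)) * key

lemma sqFlow_zero (w : PureS3) (g : S3) : sqFlow w 0 g = g := by
  apply Subtype.ext
  simp [coe_sqFlow, mult_zero, shift_zero]

/-- The one-parameter subgroup of `S³` with axis `w`. -/
def rot (w : PureS3) (θ : ℝ) : S3 :=
  ⟨planeEmb w (Complex.exp (θ * Complex.I)), by
    rw [mem_sphere_zero_iff_norm, ← sq_eq_sq₀ (norm_nonneg _) zero_le_one, sq,
      ← Quaternion.normSq_eq_norm_mul_self, normSq_planeEmb, Complex.norm_exp_ofReal_mul_I]⟩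

lemma coe_rot (w : PureS3) (θ : ℝ) :
    (rot w θ : Quaternion ℝ) = planeEmb w (Complex.exp (θ * Complex.I)) := rfl

lemma rot_add (w : PureS3) (θ θ' : ℝ) : rot w (θ + θ') = rot w θ * rot w θ' := by
  apply Subtype.ext
  rw [Metric.unitSphere.coe_mul, coe_rot, coe_rot, coe_rot, ← map_mul, ← Complex.exp_add]
  push_cast
  rw [add_mul]

lemma rot_zero (w : PureS3) : rot w 0 = 1 := by
  apply Subtype.ext
  simp [coe_rot]

lemma rot_pi (w : PureS3) : rot w Real.pi = -1 := by
  apply Subtype.ext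
  simp [coe_rot]

lemma re_rot (w : PureS3) (θ : ℝ) : (rot w θ : Quaternion ℝ).re = Real.cos θ := by
  rw [coe_rot, re_planeEmb, Complex.exp_ofReal_mul_I_re]

lemma rot_commute (w : PureS3) (θ : ℝ) : Commute (rot w θ) (w : S3) := by
  apply Subtype.ext
  rw [Metric.unitSphere.coe_mul, Metric.unitSphere.coe_mul, coe_rot, ← planeEmb_I, ← map_mul,
    ← map_mul, mul_comm]

lemma continuous_rot : Continuous fun p : PureS3 × ℝ => rot p.1 p.2 := by
  have h : Continuous fun p : PureS3 × ℝ => Complex.exp (p.2 * Complex.I) := by fun_prop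
  have h' := continuous_planeEmb.comp (continuous_fst.prodMk h)
  exact Continuous.subtype_mk h' _

lemma continuous_axial : Continuous fun p : PureS3 × S3 => axial p.1 p.2 := by
  unfold axial
  have := Quaternion.continuous_re
  fun_prop

lemma continuous_coords : Continuous fun p : PureS3 × ℝ × S3 =>
    (((p.2.2 : Quaternion ℝ).re, axial p.1 p.2.2, p.2.1) : ℝ × ℝ × ℝ) :=
  (Quaternion.continuous_re.comp (continuous_subtype_val.comp
    (continuous_snd.comp continuous_snd))).prodMk
    ((continuous_axial.comp (continuous_fst.prodMk (continuous_snd.comp continuous_snd))).prodMk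
      (continuous_fst.comp continuous_snd))

lemma continuous_mult : Continuous fun p : PureS3 × ℝ × S3 => mult p.1 p.2.1 p.2.2 := by
  have h := continuous_eta.comp continuous_coords
  exact h

lemma continuous_shift : Continuous fun p : PureS3 × ℝ × S3 => shift p.1 p.2.1 p.2.2 :=
  (continuous_fst.comp continuous_coords).mul (continuous_sinT.comp continuous_coords)

lemma continuous_sqFlow :
    Continuous fun p : PureS3 × ℝ × S3 => sqFlow p.1 p.2.1 p.2.2 := by
  have hm := continuous_mult
  have hs := continuous_shift
  have hne : ∀ p : PureS3 × ℝ × S3, ((‖mult p.1 p.2.1 p.2.2‖ : ℝ) : ℂ) ≠ 0 := fun p => by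
    exact_mod_cast (norm_mult_pos p.1 p.2.1 p.2.2).ne'
  have hn := Complex.continuous_ofReal.comp hm.norm
  have c1 : Continuous fun p : PureS3 × ℝ × S3 =>
      mult p.1 p.2.1 p.2.2 ^ 2 / ((‖mult p.1 p.2.1 p.2.2‖ : ℝ) : ℂ) :=
    (hm.pow 2).div hn hne
  have c2 : Continuous fun p : PureS3 × ℝ × S3 => mult p.1 p.2.1 p.2.2
      * shift p.1 p.2.1 p.2.2 * Complex.I / ((‖mult p.1 p.2.1 p.2.2‖ : ℝ) : ℂ) :=
    ((hm.mul (Complex.continuous_ofReal.comp hs)).mul continuous_const).div hn hne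
  have c3 : Continuous fun p : PureS3 × ℝ × S3 => (p.2.2 : Quaternion ℝ) :=
    continuous_subtype_val.comp (continuous_snd.comp continuous_snd)
  have c4 := continuous_planeEmb.comp (continuous_fst.prodMk c1)
  have c5 := continuous_planeEmb.comp (continuous_fst.prodMk c2)
  exact Continuous.subtype_mk ((c4.mul c3).sub c5) _

/-- Half the angle by which the squaring flow has rotated the square of `g` at time `s`. -/
def angle (w : PureS3) (s : ℝ) (g : S3) : ℝ :=
  ∫ t in (0 : ℝ)..s, (sqFlow w t g : Quaternion ℝ).re ^ 2

lemma continuous_re_sqFlow_sq (w : PureS3) (g : S3) :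
    Continuous fun t => (sqFlow w t g : Quaternion ℝ).re ^ 2 :=
  (Quaternion.continuous_re.comp (continuous_subtype_val.comp (continuous_sqFlow.comp
    (by fun_prop : Continuous fun t : ℝ => (w, t, g))))).pow 2

lemma hasDerivAt_angle (w : PureS3) (s : ℝ) (g : S3) :
    HasDerivAt (fun t => angle w t g) ((sqFlow w s g : Quaternion ℝ).re ^ 2) s :=
  (continuous_re_sqFlow_sq w g).integral_hasStrictDerivAt 0 s |>.hasDerivAt

lemma sqFlow_sq (w : PureS3) (s : ℝ) (g : S3) :
    sqFlow w s g ^ 2 = rot w (2 * angle w s g) * g ^ 2 := by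
  have hN : ((‖mult w s g‖ : ℝ) : ℂ) ≠ 0 := by exact_mod_cast (norm_mult_pos w s g).ne'
  have hexp : mult w s g
      = Complex.exp (2 * angle w s g * Complex.I) * conj (mult w s g) := by
    refine eta_eq_exp_mul_conj (θ := fun t => angle w t g) (re_sq_add_axial_sq_le w g)
      (by simp [angle]) (fun t => ?_) s
    have := hasDerivAt_angle w t g
    rwa [re_sqFlow] at this
  have hconj : mult w s g * conj (mult w s g) = ((‖mult w s g‖ : ℝ) : ℂ) ^ 2 := by
    rw [Complex.mul_conj, Complex.normSq_eq_norm_sq]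
    push_cast
    rfl
  have hcc : conj (mult w s g) ≠ 0 := by simpa using mult_ne_zero w s g
  have hE : Complex.exp (((2 * angle w s g : ℝ) : ℂ) * Complex.I)
      = mult w s g ^ 2 / ((‖mult w s g‖ : ℝ) : ℂ) ^ 2 := by
    rw [← hconj]
    push_cast
    field_simp
    exact hexp.symm
  apply Subtype.ext
  rw [Metric.unitSphere.coe_mul, Metric.unitSphere.coe_pow, Metric.unitSphere.coe_pow, sq, sq,
    coe_mul_self_eq, coe_mul_self_eq, re_sqFlow, coe_sqFlow, coe_rot, hE, ← planeEmb_ofReal w,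
    ← planeEmb_ofReal w, mul_sub, mul_sub, mul_one,
    ← mul_assoc (planeEmb w _) (planeEmb w _) (g : Quaternion ℝ),
    ← mul_assoc (planeEmb w _) (planeEmb w _) (g : Quaternion ℝ), ← map_mul, ← map_mul,
    ← map_mul, sub_sub, ← map_one (planeEmb w), ← map_add]
  have him : mult w s g - conj (mult w s g)
      = 2 * (((shift w s g * (g : Quaternion ℝ).re : ℝ) : ℂ) * Complex.I) := by
    apply Complex.ext
    · simp
    · simp only [mult, eta, shift]
      simp
      ring
  congr 3
  · push_cast
    field_simp
  · push_cast at him ⊢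
    field_simp
    linear_combination -(mult w s g) * him - hconj

/-- Conjugation of a purely imaginary unit quaternion. -/
def conjPure (q : S3) (w : PureS3) : PureS3 :=
  ⟨q * w * q⁻¹, by
    rw [Metric.unitSphere.coe_mul, re_mul_comm, ← Metric.unitSphere.coe_mul, inv_mul_cancel_left]
    exact w.2⟩

lemma re_conj (q g : S3) : ((q * g * q⁻¹ : S3) : Quaternion ℝ).re = (g : Quaternion ℝ).re := by
  rw [Metric.unitSphere.coe_mul, re_mul_comm, ← Metric.unitSphere.coe_mul, inv_mul_cancel_left]

lemma coe_mul_inv_self (q : S3) : (q : Quaternion ℝ) * ((q⁻¹ : S3) : Quaternion ℝ) = 1 := by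
  rw [← Metric.unitSphere.coe_mul, mul_inv_cancel, Metric.unitSphere.coe_one]

lemma coe_inv_mul_self (q : S3) : ((q⁻¹ : S3) : Quaternion ℝ) * (q : Quaternion ℝ) = 1 := by
  rw [← Metric.unitSphere.coe_mul, inv_mul_cancel, Metric.unitSphere.coe_one]

lemma planeEmb_conjPure (q : S3) (w : PureS3) (z : ℂ) :
    planeEmb (conjPure q w) z = q * planeEmb w z * ((q⁻¹ : S3) : Quaternion ℝ) := by
  have h : (((conjPure q w : PureS3) : S3) : Quaternion ℝ)
      = q * ((w : S3) : Quaternion ℝ) * ((q⁻¹ : S3) : Quaternion ℝ) := rfl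
  rw [planeEmb_apply, planeEmb_apply, h, mul_add, add_mul, ← Quaternion.coe_commutes,
    mul_assoc _ (q : Quaternion ℝ), coe_mul_inv_self, mul_one, mul_smul_comm, smul_mul_assoc]

lemma axial_conj (q : S3) (w : PureS3) (g : S3) :
    axial (conjPure q w) (q * g * q⁻¹) = axial w g := by
  have h : ((conjPure q w : PureS3) : S3) * (q * g * q⁻¹) = q * ((w : S3) * g) * q⁻¹ := by
    simp only [conjPure]
    group
  rw [axial, ← Metric.unitSphere.coe_mul, h, re_conj, Metric.unitSphere.coe_mul, axial]

lemma sqFlow_conj (q : S3) (w : PureS3) (s : ℝ) (g : S3) :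
    sqFlow (conjPure q w) s (q * g * q⁻¹) = q * sqFlow w s g * q⁻¹ := by
  have hm : mult (conjPure q w) s (q * g * q⁻¹) = mult w s g := by
    rw [mult, re_conj, axial_conj, mult]
  have hs : shift (conjPure q w) s (q * g * q⁻¹) = shift w s g := by
    rw [shift, re_conj, axial_conj, shift]
  apply Subtype.ext
  rw [Metric.unitSphere.coe_mul, Metric.unitSphere.coe_mul, coe_sqFlow, coe_sqFlow, hm, hs,
    planeEmb_conjPure, planeEmb_conjPure, Metric.unitSphere.coe_mul, Metric.unitSphere.coe_mul,
    mul_sub, sub_mul]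
  congr 1
  simp only [mul_assoc]
  rw [← mul_assoc ((q⁻¹ : S3) : Quaternion ℝ) (q : Quaternion ℝ), coe_inv_mul_self, one_mul]

lemma rot_conjPure (q : S3) (w : PureS3) (θ : ℝ) :
    rot (conjPure q w) θ = q * rot w θ * q⁻¹ := by
  apply Subtype.ext
  rw [coe_rot, planeEmb_conjPure, Metric.unitSphere.coe_mul, Metric.unitSphere.coe_mul, coe_rot]

lemma angle_zero (w : PureS3) (g : S3) : angle w 0 g = 0 := by simp [angle]

lemma angle_add (w : PureS3) (s t : ℝ) (g : S3) :
    angle w (s + t) g = angle w s g + angle w t (sqFlow w s g) := by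
  have hc := continuous_re_sqFlow_sq w g
  have h : angle w t (sqFlow w s g)
      = ∫ x in (0 + s)..(t + s), (sqFlow w x g : Quaternion ℝ).re ^ 2 := by
    rw [← intervalIntegral.integral_comp_add_right
      (fun x => (sqFlow w x g : Quaternion ℝ).re ^ 2) s]
    simp only [angle, ← sqFlow_add, add_comm s]
  rw [h, zero_add, add_comm t s, angle, angle, intervalIntegral.integral_add_adjacent_intervals
    (hc.intervalIntegrable _ _) (hc.intervalIntegrable _ _)]

lemma angle_conj (q : S3) (w : PureS3) (s : ℝ) (g : S3) :
    angle (conjPure q w) s (q * g * q⁻¹) = angle w s g := by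
  simp only [angle, sqFlow_conj, re_conj]

lemma continuous_angle : Continuous fun p : PureS3 × ℝ × S3 => angle p.1 p.2.1 p.2.2 := by
  have h1 : Continuous fun p : (PureS3 × ℝ × S3) × ℝ => (p.1.1, p.2, p.1.2.2) := by fun_prop
  have h2 := (continuous_pow 2).comp
    (Quaternion.continuous_re.comp (continuous_subtype_val.comp (continuous_sqFlow.comp h1)))
  have h4 : Continuous (Function.uncurry
      fun (p : PureS3 × ℝ × S3) t => (sqFlow p.1 t p.2.2 : Quaternion ℝ).re ^ 2) := h2
  have h3 : Continuous fun p : PureS3 × ℝ × S3 => p.2.1 := by fun_prop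
  exact intervalIntegral.continuous_parametric_intervalIntegral_of_continuous h4 h3

lemma re_sqFlow_ne_zero {w : PureS3} {s : ℝ} {g : S3} (h : (g : Quaternion ℝ).re ≠ 0) :
    (sqFlow w s g : Quaternion ℝ).re ≠ 0 := by
  rw [re_sqFlow]
  exact div_ne_zero h (norm_mult_pos w s g).ne'

lemma continuous_conjPure : Continuous fun p : S3 × PureS3 => conjPure p.1 p.2 :=
  Continuous.subtype_mk ((continuous_fst.mul (continuous_subtype_val.comp continuous_snd)).mul
    continuous_fst.inv) _

lemma conjPure_mul (p q : S3) (w : PureS3) : conjPure (p * q) w = conjPure p (conjPure q w) := by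
  apply Subtype.ext
  simp only [conjPure]
  group

lemma conjPure_rot (u : PureS3) (θ : ℝ) : conjPure (rot u θ)⁻¹ u = u := by
  apply Subtype.ext
  have h := (rot_commute u θ).inv_left
  simp only [conjPure]
  rw [h.eq, mul_inv_cancel_right]

section TupleFlow

variable {n : ℕ}

/-- The partial products `g₀² ⋯ g_{i-1}²`. -/
def prodSq (g : Fin (n + 1) → S3) (i : Fin (n + 2)) : S3 := Fin.partialProd (fun j => g j ^ 2) i

lemma prodSq_zero (g : Fin (n + 1) → S3) : prodSq g 0 = 1 := Fin.partialProd_zero _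

lemma prodSq_succ (g : Fin (n + 1) → S3) (i : Fin (n + 1)) :
    prodSq g i.succ = prodSq g i.castSucc * g i ^ 2 := Fin.partialProd_succ _ _

lemma prodSq_last (g : Fin (n + 1) → S3) : prodSq g (Fin.last (n + 1)) = box n g := by
  rw [prodSq, Fin.partialProd, box, List.take_of_length_le (by simp), List.ofFn_eq_map]

lemma continuous_prodSq (i : Fin (n + 2)) :
    Continuous fun g : Fin (n + 1) → S3 => prodSq g i := by
  induction i using Fin.induction with
  | zero => simp only [prodSq_zero]; exact continuous_const
  | succ i ih => simp only [prodSq_succ]; exact ih.mul ((continuous_apply i).pow 2)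

lemma continuous_box : Continuous (box n) := by
  have h := continuous_prodSq (Fin.last (n + 1))
  simpa only [prodSq_last] using h

lemma prodSq_conj (q : S3) (g : Fin (n + 1) → S3) (i : Fin (n + 2)) :
    prodSq (fun j => q * g j * q⁻¹) i = q * prodSq g i * q⁻¹ := by
  induction i using Fin.induction with
  | zero => simp [prodSq_zero]
  | succ i ih =>
    rw [prodSq_succ, prodSq_succ, ih, conj_pow]
    group

lemma box_conj (q : S3) (g : Fin (n + 1) → S3) :
    box n (fun j => q * g j * q⁻¹) = q * box n g * q⁻¹ := by
  rw [← prodSq_last, prodSq_conj, prodSq_last]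

/-- The axis `u`, transported past the first `i` squares of the tuple. -/
def axis (u : PureS3) (g : Fin (n + 1) → S3) (i : Fin (n + 1)) : PureS3 :=
  conjPure (prodSq g i.castSucc)⁻¹ u

/-- The flow on tuples which rotates the product of squares about the axis `u`. -/
def tupleFlow (u : PureS3) (s : ℝ) (g : Fin (n + 1) → S3) (i : Fin (n + 1)) : S3 :=
  sqFlow (axis u g i) s (g i)

/-- Half the angle by which `tupleFlow` has rotated the product of squares at time `s`. -/
def tupleAngle (u : PureS3) (s : ℝ) (g : Fin (n + 1) → S3) : ℝ :=
  ∑ i, angle (axis u g i) s (g i)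

/-- The sum of the squared real parts. -/
def reSqSum (g : Fin (n + 1) → S3) : ℝ := ∑ i, (g i : Quaternion ℝ).re ^ 2

lemma prodSq_tupleFlow (u : PureS3) (s : ℝ) (g : Fin (n + 1) → S3) (i : Fin (n + 2)) :
    prodSq (tupleFlow u s g) i
      = rot u (2 * Fin.partialSum (fun j => angle (axis u g j) s (g j)) i) * prodSq g i := by
  induction i using Fin.induction with
  | zero => simp [prodSq_zero, rot_zero]
  | succ i ih =>
    rw [prodSq_succ, prodSq_succ, ih, Fin.partialSum_succ, mul_add, rot_add, tupleFlow, sqFlow_sq,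
      show axis u g i = conjPure (prodSq g i.castSucc)⁻¹ u from rfl, rot_conjPure]
    group

lemma box_tupleFlow (u : PureS3) (s : ℝ) (g : Fin (n + 1) → S3) :
    box n (tupleFlow u s g) = rot u (2 * tupleAngle u s g) * box n g := by
  have h : Fin.partialSum (fun j => angle (axis u g j) s (g j)) (Fin.last (n + 1))
      = tupleAngle u s g := by
    rw [Fin.partialSum, tupleAngle, List.take_of_length_le (by simp), List.sum_ofFn]
  rw [← prodSq_last, prodSq_tupleFlow, prodSq_last, h]

lemma axis_tupleFlow (u : PureS3) (s : ℝ) (g : Fin (n + 1) → S3) (i : Fin (n + 1)) :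
    axis u (tupleFlow u s g) i = axis u g i := by
  rw [axis, prodSq_tupleFlow, mul_inv_rev, conjPure_mul, conjPure_rot, axis]

lemma tupleFlow_zero (u : PureS3) (g : Fin (n + 1) → S3) : tupleFlow u 0 g = g :=
  funext fun _ => sqFlow_zero _ _

lemma tupleFlow_add (u : PureS3) (s t : ℝ) (g : Fin (n + 1) → S3) :
    tupleFlow u (s + t) g = tupleFlow u t (tupleFlow u s g) := by
  funext i
  rw [tupleFlow, sqFlow_add, tupleFlow, axis_tupleFlow, tupleFlow]

lemma tupleAngle_zero (u : PureS3) (g : Fin (n + 1) → S3) : tupleAngle u 0 g = 0 := by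
  simp [tupleAngle, angle_zero]

lemma tupleAngle_add (u : PureS3) (s t : ℝ) (g : Fin (n + 1) → S3) :
    tupleAngle u (s + t) g = tupleAngle u s g + tupleAngle u t (tupleFlow u s g) := by
  simp only [tupleAngle, angle_add, Finset.sum_add_distrib, axis_tupleFlow, tupleFlow]

lemma axis_conj (q : S3) (u : PureS3) (g : Fin (n + 1) → S3) (i : Fin (n + 1)) :
    axis (conjPure q u) (fun j => q * g j * q⁻¹) i = conjPure q (axis u g i) := by
  simp only [axis, prodSq_conj, ← conjPure_mul]
  congr 1
  group

lemma tupleFlow_conj (q : S3) (u : PureS3) (s : ℝ) (g : Fin (n + 1) → S3) :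
    tupleFlow (conjPure q u) s (fun j => q * g j * q⁻¹)
      = fun j => q * tupleFlow u s g j * q⁻¹ := by
  funext i
  rw [tupleFlow, axis_conj, sqFlow_conj, tupleFlow]

lemma tupleAngle_conj (q : S3) (u : PureS3) (s : ℝ) (g : Fin (n + 1) → S3) :
    tupleAngle (conjPure q u) s (fun j => q * g j * q⁻¹) = tupleAngle u s g := by
  simp only [tupleAngle, axis_conj, angle_conj]

lemma continuous_axis (i : Fin (n + 1)) :
    Continuous fun p : PureS3 × (Fin (n + 1) → S3) => axis p.1 p.2 i := by
  have h1 := ((continuous_prodSq i.castSucc).comp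
    (continuous_snd : Continuous fun p : PureS3 × (Fin (n + 1) → S3) => p.2)).inv
  have h2 := continuous_conjPure.comp (h1.prodMk continuous_fst)
  exact h2

lemma continuous_axis_coords (i : Fin (n + 1)) :
    Continuous fun p : PureS3 × ℝ × (Fin (n + 1) → S3) => (axis p.1 p.2.2 i, p.2.1, p.2.2 i) := by
  have h1 := (continuous_axis i).comp (continuous_fst.prodMk (continuous_snd.comp continuous_snd) :
    Continuous fun p : PureS3 × ℝ × (Fin (n + 1) → S3) => (p.1, p.2.2))
  exact h1.prodMk ((continuous_fst.comp continuous_snd).prodMk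
    ((continuous_apply i).comp (continuous_snd.comp continuous_snd)))

lemma continuous_tupleFlow :
    Continuous fun p : PureS3 × ℝ × (Fin (n + 1) → S3) => tupleFlow p.1 p.2.1 p.2.2 := by
  refine continuous_pi fun i => ?_
  have h := continuous_sqFlow.comp (continuous_axis_coords i)
  exact h

lemma continuous_tupleAngle :
    Continuous fun p : PureS3 × ℝ × (Fin (n + 1) → S3) => tupleAngle p.1 p.2.1 p.2.2 := by
  refine continuous_finsetSum _ fun i _ => ?_
  have h := continuous_angle.comp (continuous_axis_coords i)
  exact h

lemma continuous_reSqSum : Continuous (reSqSum (n := n)) :=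
  continuous_finsetSum _ fun i _ =>
    (Quaternion.continuous_re.comp (continuous_subtype_val.comp (continuous_apply i))).pow 2

lemma hasDerivAt_tupleAngle (u : PureS3) (s : ℝ) (g : Fin (n + 1) → S3) :
    HasDerivAt (fun t => tupleAngle u t g) (reSqSum (tupleFlow u s g)) s :=
  HasDerivAt.fun_sum fun i _ => hasDerivAt_angle (axis u g i) s (g i)

lemma reSqSum_nonneg (g : Fin (n + 1) → S3) : 0 ≤ reSqSum g :=
  Finset.sum_nonneg fun _ _ => sq_nonneg _

lemma reSqSum_tupleFlow_pos {g : Fin (n + 1) → S3} (h : 0 < reSqSum g) (u : PureS3) (s : ℝ) :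
    0 < reSqSum (tupleFlow u s g) := by
  obtain ⟨i, -, hi⟩ := Finset.exists_ne_zero_of_sum_ne_zero h.ne'
  exact Finset.sum_pos' (fun _ _ => sq_nonneg _)
    ⟨i, Finset.mem_univ i, sq_pos_of_ne_zero (re_sqFlow_ne_zero fun h0 => hi (by rw [h0]; simp))⟩

lemma strictMono_tupleAngle {g : Fin (n + 1) → S3} (h : 0 < reSqSum g) (u : PureS3) :
    StrictMono fun s => tupleAngle u s g :=
  strictMono_of_hasDerivAt_pos (hasDerivAt_tupleAngle u · g) (reSqSum_tupleFlow_pos h u)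

lemma reSqSum_pos_of_box_ne {g : Fin (n + 1) → S3} (h : box n g ≠ (-1) ^ (n + 1)) :
    0 < reSqSum g := by
  refine (reSqSum_nonneg g).lt_of_ne fun h0 => h ?_
  have h1 : ∀ i, g i ^ 2 = -1 := by
    intro i
    have h2 := (Finset.sum_eq_zero_iff_of_nonneg fun _ _ => sq_nonneg _).mp h0.symm i
      (Finset.mem_univ i)
    apply Subtype.ext
    rw [Metric.unitSphere.coe_pow, sq, coe_mul_self_eq, pow_eq_zero_iff two_ne_zero |>.mp h2]
    simp
  simp only [box, h1, List.map_const', List.length_finRange, List.prod_replicate]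

end TupleFlow

lemma exists_eq_of_hasDerivAt_ge_of_nonneg {f f' : ℝ → ℝ} (h0 : f 0 = 0)
    (hd : ∀ s, HasDerivAt f (f' s) s) (hn : ∀ s, 0 ≤ f' s) {δ m : ℝ} (hδ : 0 ≤ δ) (hm : 0 < m)
    (hb : ∀ s, f s ∈ Set.Icc 0 δ → m ≤ f' s) : ∃ s, f s = δ := by
  have hmono : Monotone f := monotone_of_deriv_nonneg (fun s => (hd s).differentiableAt)
    fun s => by rw [(hd s).deriv]; exact hn s
  have hcont : Continuous f := continuous_iff_continuousAt.mpr fun s => (hd s).continuousAt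
  have hT : 0 ≤ δ / m := by positivity
  have hle : δ ≤ f (δ / m) := by
    by_contra! hlt
    have h1 : ∀ s ∈ Set.Icc 0 (δ / m), f s ∈ Set.Icc 0 δ := fun s hs =>
      ⟨h0 ▸ hmono hs.1, (hmono hs.2).trans hlt.le⟩
    have h2 := Convex.mul_sub_le_image_sub_of_le_deriv (convex_Icc 0 (δ / m)) hcont.continuousOn
      (fun s _ => (hd s).differentiableAt.differentiableWithinAt) (C := m)
      (fun s hs => by
        rw [(hd s).deriv]
        exact hb s (h1 s (interior_subset hs)))
      0 ⟨le_rfl, hT⟩ (δ / m) ⟨hT, le_rfl⟩ hT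
    rw [h0, sub_zero, sub_zero, mul_div_cancel₀ _ hm.ne'] at h2
    linarith
  obtain ⟨s, -, hs⟩ := intermediate_value_Icc hT hcont.continuousOn ⟨h0.le.trans hδ, hle⟩
  exact ⟨s, hs⟩

lemma exists_eq_of_hasDerivAt_ge {f f' : ℝ → ℝ} (h0 : f 0 = 0)
    (hd : ∀ s, HasDerivAt f (f' s) s) (hn : ∀ s, 0 ≤ f' s) {δ m : ℝ} (hm : 0 < m)
    (hb : ∀ s, f s ∈ Set.uIcc 0 δ → m ≤ f' s) : ∃ s, f s = δ := by
  rcases le_total 0 δ with hδ | hδ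
  · rw [Set.uIcc_of_le hδ] at hb
    exact exists_eq_of_hasDerivAt_ge_of_nonneg h0 hd hn hδ hm hb
  · rw [Set.uIcc_of_ge hδ] at hb
    have hd' : ∀ s, HasDerivAt (fun s => -f (-s)) (f' (-s)) s := fun s => by
      have h := (HasDerivAt.scomp s (hd (-s)) (hasDerivAt_neg s)).neg
      rw [neg_one_smul, neg_neg] at h
      exact h
    obtain ⟨s, hs⟩ := exists_eq_of_hasDerivAt_ge_of_nonneg (f := fun s => -f (-s)) (δ := -δ)
      (by simp [h0]) hd' (fun s => hn (-s)) (by linarith) hm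
      (fun s hs => hb (-s) ⟨by linarith [hs.2], by linarith [hs.1]⟩)
    exact ⟨-s, by linarith⟩

lemma continuous_of_strictMono_eq {Y : Type*} [TopologicalSpace Y] {f : Y → ℝ → ℝ}
    (hf : ∀ a, Continuous fun y => f y a) (hm : ∀ y, StrictMono (f y)) {δ : ℝ} {s : Y → ℝ}
    (hs : ∀ y, f y (s y) = δ) : Continuous s := by
  refine continuous_iff_continuousAt.mpr fun y => tendsto_order.mpr ⟨fun a ha => ?_, fun a ha => ?_⟩
  · have h : f y a < δ := hs y ▸ hm y ha
    filter_upwards [(hf a).continuousAt.eventually_lt_const h] with z hz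
    exact (hm z).lt_iff_lt.mp (hs z ▸ hz)
  · have h : δ < f y a := hs y ▸ hm y ha
    filter_upwards [(hf a).continuousAt.eventually_const_lt h] with z hz
    exact (hm z).lt_iff_lt.mp (hs z ▸ hz)

/-- The angles in `[0, π]` whose rotation is different from the singular value `(-1) ^ (n + 1)`. -/
def regularAngles (n : ℕ) : Set ℝ :=
  if Even n then Set.Ico 0 Real.pi else Set.Ioc 0 Real.pi

/-- The angle of the regular value `(-1) ^ n`. -/
def regularAngle (n : ℕ) : ℝ := if Even n then 0 else Real.pi

lemma regularAngle_mem (n : ℕ) : regularAngle n ∈ regularAngles n := by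
  unfold regularAngle regularAngles
  split_ifs <;> simp [Real.pi_pos]

lemma rot_regularAngle (n : ℕ) (u : PureS3) : rot u (regularAngle n) = (-1) ^ n := by
  unfold regularAngle
  split_ifs with h
  · rw [rot_zero, h.neg_one_pow]
  · rw [rot_pi, (Nat.not_even_iff_odd.mp h).neg_one_pow]

lemma Ioo_subset_regularAngles (n : ℕ) : Set.Ioo 0 Real.pi ⊆ regularAngles n := by
  unfold regularAngles
  split_ifs
  · exact Set.Ioo_subset_Ico_self
  · exact Set.Ioo_subset_Ioc_self

instance (n : ℕ) : (regularAngles n).OrdConnected := by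
  unfold regularAngles
  split_ifs
  · exact Set.ordConnected_Ico
  · exact Set.ordConnected_Ioc

lemma rot_ne_of_mem_regularAngles {n : ℕ} {θ : ℝ} (h : θ ∈ regularAngles n) (u : PureS3) :
    rot u θ ≠ (-1) ^ (n + 1) := by
  unfold regularAngles at h
  split_ifs at h with hn
  · rw [hn.add_one.neg_one_pow, ← rot_pi u]
    intro h'
    have h2 := congrArg (fun g : S3 => (g : Quaternion ℝ).re) h'
    simp only [re_rot] at h2
    exact (Real.cos_lt_cos_of_nonneg_of_le_pi h.1 le_rfl h.2).ne' h2
  · rw [(Nat.not_even_iff_odd.mp hn).add_one.neg_one_pow, ← rot_zero u]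
    intro h'
    have h2 := congrArg (fun g : S3 => (g : Quaternion ℝ).re) h'
    simp only [re_rot] at h2
    exact (Real.cos_lt_cos_of_nonneg_of_le_pi le_rfl h.2 h.1).ne h2

section Transport

variable {n : ℕ}

lemma exists_tupleAngle_eq {u : PureS3} {g : Fin (n + 1) → S3} {α δ : ℝ}
    (hg : box n g = rot u α) (hα : α ∈ regularAngles n) (hδ : α + 2 * δ ∈ regularAngles n) :
    ∃ s, tupleAngle u s g = δ := by
  have hmem : ∀ t ∈ Set.uIcc 0 δ, α + 2 * t ∈ regularAngles n := by
    intro t ht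
    apply Set.OrdConnected.uIcc_subset inferInstance hα hδ
    rcases le_total 0 δ with h | h
    · rw [Set.uIcc_of_le h] at ht
      rw [Set.uIcc_of_le (by linarith)]
      exact ⟨by linarith [ht.1], by linarith [ht.2]⟩
    · rw [Set.uIcc_of_ge h] at ht
      rw [Set.uIcc_of_ge (by linarith)]
      exact ⟨by linarith [ht.1], by linarith [ht.2]⟩
  set K : Set (Fin (n + 1) → S3) := box n ⁻¹' ((fun t => rot u (α + 2 * t)) '' Set.uIcc 0 δ)
  have hrot : Continuous fun t : ℝ => rot u (α + 2 * t) := by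
    have h : Continuous fun t : ℝ => (u, α + 2 * t) := by fun_prop
    have h' := continuous_rot.comp h
    exact h'
  have hK : IsCompact K :=
    ((isCompact_uIcc.image hrot).isClosed.preimage continuous_box).isCompact
  have hne : K.Nonempty := ⟨g, 0, Set.left_mem_uIcc, by simp [hg]⟩
  obtain ⟨k, hk, hmin⟩ := hK.exists_isMinOn hne continuous_reSqSum.continuousOn
  have hpos : 0 < reSqSum k := by
    obtain ⟨t, ht, htk⟩ := hk
    exact reSqSum_pos_of_box_ne (htk ▸ rot_ne_of_mem_regularAngles (hmem t ht) u)
  refine exists_eq_of_hasDerivAt_ge (tupleAngle_zero u g) (hasDerivAt_tupleAngle u · g)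
    (fun s => reSqSum_nonneg _) hpos fun s hs => hmin ⟨tupleAngle u s g, hs, ?_⟩
  rw [box_tupleFlow, hg, ← rot_add, add_comm]

lemma strictMono_tupleAngle_of_box_eq {u : PureS3} {g : Fin (n + 1) → S3} {α : ℝ}
    (hg : box n g = rot u α) (hα : α ∈ regularAngles n) :
    StrictMono fun s => tupleAngle u s g :=
  strictMono_tupleAngle (reSqSum_pos_of_box_ne (hg ▸ rot_ne_of_mem_regularAngles hα u)) u

/-- A time at which `tupleFlow` has rotated the product of squares by `2 * δ`. -/
def flowTime (u : PureS3) (δ : ℝ) (g : Fin (n + 1) → S3) : ℝ :=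
  Classical.epsilon fun s => tupleAngle u s g = δ

/-- Flowing a tuple until its product of squares has been rotated by `2 * δ`. -/
def transport (u : PureS3) (δ : ℝ) (g : Fin (n + 1) → S3) : Fin (n + 1) → S3 :=
  tupleFlow u (flowTime u δ g) g

lemma tupleAngle_flowTime {u : PureS3} {g : Fin (n + 1) → S3} {α δ : ℝ}
    (hg : box n g = rot u α) (hα : α ∈ regularAngles n) (hδ : α + 2 * δ ∈ regularAngles n) :
    tupleAngle u (flowTime u δ g) g = δ :=
  Classical.epsilon_spec (exists_tupleAngle_eq hg hα hδ)

lemma box_transport {u : PureS3} {g : Fin (n + 1) → S3} {α δ : ℝ}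
    (hg : box n g = rot u α) (hα : α ∈ regularAngles n) (hδ : α + 2 * δ ∈ regularAngles n) :
    box n (transport u δ g) = rot u (α + 2 * δ) := by
  rw [transport, box_tupleFlow, tupleAngle_flowTime hg hα hδ, hg, ← rot_add, add_comm]

lemma transport_neg_transport {u : PureS3} {g : Fin (n + 1) → S3} {α δ : ℝ}
    (hg : box n g = rot u α) (hα : α ∈ regularAngles n) (hδ : α + 2 * δ ∈ regularAngles n) :
    transport u (-δ) (transport u δ g) = g := by
  have h1 := box_transport hg hα hδ
  have h2 := tupleAngle_flowTime (δ := -δ) h1 hδ (by simpa using hα)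
  have h3 := tupleAngle_add u (flowTime u δ g) (-flowTime u δ g) g
  rw [add_neg_cancel, tupleAngle_zero, tupleAngle_flowTime hg hα hδ] at h3
  have h4 : flowTime u (-δ) (transport u δ g) = -flowTime u δ g := by
    refine (strictMono_tupleAngle_of_box_eq h1 hδ).injective (h2.trans ?_)
    change -δ = tupleAngle u (-flowTime u δ g) (tupleFlow u (flowTime u δ g) g)
    linarith
  rw [transport, h4, transport, ← tupleFlow_add, add_neg_cancel, tupleFlow_zero]

lemma transport_conj (q : S3) (u : PureS3) (δ : ℝ) (g : Fin (n + 1) → S3) :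
    transport (conjPure q u) δ (fun j => q * g j * q⁻¹)
      = fun j => q * transport u δ g j * q⁻¹ := by
  simp only [transport, flowTime, tupleAngle_conj, tupleFlow_conj]

lemma continuous_transport {Y : Type*} [TopologicalSpace Y] {u : Y → PureS3}
    {g : Y → Fin (n + 1) → S3} (hu : Continuous u) (hgc : Continuous g) {α δ : ℝ}
    (hg : ∀ y, box n (g y) = rot (u y) α) (hα : α ∈ regularAngles n)
    (hδ : α + 2 * δ ∈ regularAngles n) : Continuous fun y => transport (u y) δ (g y) := by
  have hs : Continuous fun y => flowTime (u y) δ (g y) := by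
    refine continuous_of_strictMono_eq (f := fun y s => tupleAngle (u y) s (g y)) (fun a => ?_)
      (fun y => strictMono_tupleAngle_of_box_eq (hg y) hα)
      (fun y => tupleAngle_flowTime (hg y) hα hδ)
    have h := continuous_tupleAngle.comp (hu.prodMk ((continuous_const (y := a)).prodMk hgc))
    exact h
  have h := continuous_tupleFlow.comp (hu.prodMk (hs.prodMk hgc))
  exact h

end Transport

/-- The axis of a unit quaternion with real part `cos φ`. -/
def axisOf {φ : ℝ} (hφ : Real.sin φ ≠ 0) (x : {x : S3 // (x : Quaternion ℝ).re = Real.cos φ}) :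
    PureS3 :=
  ⟨⟨(Real.sin φ)⁻¹ • ((x : S3) - ((Real.cos φ : ℝ) : Quaternion ℝ)), by
    have h1 := sum_sq_eq_one x
    have h2 := Real.sin_sq_add_cos_sq φ
    rw [x.2] at h1
    rw [mem_sphere_zero_iff_norm, ← sq_eq_sq₀ (norm_nonneg _) zero_le_one, sq,
      ← Quaternion.normSq_eq_norm_mul_self, Quaternion.normSq_def']
    simp [x.2]
    field_simp
    linarith⟩, by simp [x.2]⟩

lemma rot_axisOf {φ : ℝ} (hφ : Real.sin φ ≠ 0)
    (x : {x : S3 // (x : Quaternion ℝ).re = Real.cos φ}) : rot (axisOf hφ x) φ = x := by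
  apply Subtype.ext
  rw [coe_rot, planeEmb_apply, Complex.exp_ofReal_mul_I_re, Complex.exp_ofReal_mul_I_im, axisOf,
    smul_inv_smul₀ hφ, add_sub_cancel]

lemma axisOf_conj {φ : ℝ} (hφ : Real.sin φ ≠ 0) (q : S3)
    (x y : {x : S3 // (x : Quaternion ℝ).re = Real.cos φ}) (h : (y : S3) = q * x * q⁻¹) :
    axisOf hφ y = conjPure q (axisOf hφ x) := by
  apply Subtype.ext
  apply Subtype.ext
  have h' := congrArg (fun g : S3 => (g : Quaternion ℝ)) h
  simp only [Metric.unitSphere.coe_mul] at h'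
  simp only [conjPure, axisOf, Metric.unitSphere.coe_mul, h']
  rw [mul_smul_comm, smul_mul_assoc, mul_sub, sub_mul, ← Quaternion.coe_commutes,
    mul_assoc _ (q : Quaternion ℝ), coe_mul_inv_self, mul_one]

lemma continuous_axisOf {φ : ℝ} (hφ : Real.sin φ ≠ 0) : Continuous (axisOf hφ) := by
  have h : Continuous fun x : {x : S3 // (x : Quaternion ℝ).re = Real.cos φ} =>
      (Real.sin φ)⁻¹ • (((x : S3) : Quaternion ℝ) - ((Real.cos φ : ℝ) : Quaternion ℝ)) := by
    fun_prop
  exact Continuous.subtype_mk (Continuous.subtype_mk h _) _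

lemma eq_one_of_re_eq_one {g : S3} (h : (g : Quaternion ℝ).re = 1) : g = 1 := by
  have h1 := sum_sq_eq_one g
  rw [h] at h1
  have hI : (g : Quaternion ℝ).imI = 0 := by nlinarith
  have hJ : (g : Quaternion ℝ).imJ = 0 := by nlinarith
  have hK : (g : Quaternion ℝ).imK = 0 := by nlinarith
  apply Subtype.ext
  apply Quaternion.ext
  exacts [h, hI, hJ, hK]

lemma exists_re_eq_cos {c : S3} (h1 : c ≠ 1) (h2 : c ≠ -1) :
    ∃ φ ∈ Set.Ioo 0 Real.pi, (c : Quaternion ℝ).re = Real.cos φ := by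
  have hs := sum_sq_eq_one c
  have hle : (c : Quaternion ℝ).re ≤ 1 := by nlinarith
  have hge : -1 ≤ (c : Quaternion ℝ).re := by nlinarith
  have hlt : (c : Quaternion ℝ).re < 1 := hle.lt_of_ne fun h => h1 (eq_one_of_re_eq_one h)
  have hgt : -1 < (c : Quaternion ℝ).re := hge.lt_of_ne fun h => h2 (neg_eq_iff_eq_neg.mp
    (eq_one_of_re_eq_one (by change -(c : Quaternion ℝ).re = 1; linarith)))
  refine ⟨Real.arccos (c : Quaternion ℝ).re, ⟨Real.arccos_pos.mpr hlt,
    Real.arccos_lt_pi.mpr hgt⟩, (Real.cos_arccos hge hle).symm⟩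

lemma re_of_mem_conjClass {c x : S3} (h : x ∈ conjClass c) :
    (x : Quaternion ℝ).re = (c : Quaternion ℝ).re := by
  obtain ⟨q, rfl⟩ := h
  exact re_conj q c

/-- For a non-central conjugacy class `C` of `c ∈ S³`, there is an `S³`-equivariant
homeomorphism `Xₙ(C) ≅ C × Xₙ^r`, where `S³` acts by componentwise conjugation on
tuples and by conjugation on `C`. -/
theorem stmt7 (n : ℕ) (c : S3) (h1 : c ≠ 1) (h2 : c ≠ -1) :
    ∃ e : XC n c ≃ₜ (↥(conjClass c) × X n ((-1 : S3) ^ n)),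
      ∀ (q : S3) (g g' : XC n c),
        (∀ i, g'.val i = q * g.val i * q⁻¹) →
          ((e g').1 : S3) = q * ((e g).1 : S3) * q⁻¹ ∧
          ∀ i, ((e g').2).val i = q * ((e g).2).val i * q⁻¹ := by
  obtain ⟨φ, hφ, hc⟩ := exists_re_eq_cos h1 h2
  have hsin : Real.sin φ ≠ 0 := (Real.sin_pos_of_mem_Ioo hφ).ne'
  have hφ' := Ioo_subset_regularAngles n hφ
  set ψ := regularAngle n
  have hψ : ψ ∈ regularAngles n := regularAngle_mem n
  have hadd : φ + 2 * ((ψ - φ) / 2) = ψ := by ring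
  have hsub : ψ + 2 * -((ψ - φ) / 2) = φ := by ring
  have hadd' : φ + 2 * ((ψ - φ) / 2) ∈ regularAngles n := by rwa [hadd]
  have hsub' : ψ + 2 * -((ψ - φ) / 2) ∈ regularAngles n := by rwa [hsub]
  generalize (ψ - φ) / 2 = δ at *
  have hre : ∀ x ∈ conjClass c, (x : Quaternion ℝ).re = Real.cos φ := fun x hx =>
    (re_of_mem_conjClass hx).trans hc
  let u : conjClass c → PureS3 := fun x => axisOf hsin ⟨x, hre x x.2⟩
  have hu : Continuous u := (continuous_axisOf hsin).comp (continuous_subtype_val.subtype_mk _)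
  have hrot : ∀ x : conjClass c, rot (u x) φ = x := fun x => rot_axisOf hsin _
  let p : XC n c → conjClass c := fun g => ⟨box n g.1, g.2⟩
  have hp : Continuous p := (continuous_box.comp continuous_subtype_val).subtype_mk _
  have hg : ∀ g : XC n c, box n g.1 = rot (u (p g)) φ := fun g => (hrot (p g)).symm
  have hh : ∀ (x : conjClass c) (h : X n ((-1) ^ n)), box n h.1 = rot (u x) ψ := fun x h =>
    h.2.trans (rot_regularAngle n (u x)).symm
  have hbox : ∀ (x : conjClass c) (h : X n ((-1) ^ n)), box n (transport (u x) (-δ) h.1) = x := by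
    intro x h
    rw [box_transport (hh x h) hψ hsub', hsub, hrot]
  have hbox' : ∀ g : XC n c, box n (transport (u (p g)) δ g.1) = (-1) ^ n := by
    intro g
    rw [box_transport (hg g) hφ' hadd', hadd, rot_regularAngle]
  have hmem : ∀ y : conjClass c × X n ((-1 : S3) ^ n),
      box n (transport (u y.1) (-δ) y.2.1) ∈ conjClass c := fun y => by
    rw [hbox]
    exact y.1.2
  have hc1 : Continuous fun g : XC n c => transport (u (p g)) δ g.1 :=
    continuous_transport (hu.comp hp) continuous_subtype_val hg hφ' hadd'
  have hc2 : Continuous fun y : conjClass c × X n ((-1 : S3) ^ n) =>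
      transport (u y.1) (-δ) y.2.1 :=
    continuous_transport (hu.comp continuous_fst) (continuous_subtype_val.comp continuous_snd)
      (fun y => hh y.1 y.2) hψ hsub'
  let e : XC n c ≃ₜ (conjClass c × X n ((-1 : S3) ^ n)) :=
    { toFun := fun g => (p g, ⟨transport (u (p g)) δ g.1, hbox' g⟩)
      invFun := fun y => ⟨transport (u y.1) (-δ) y.2.1, hmem y⟩
      left_inv := fun g => Subtype.ext (transport_neg_transport (hg g) hφ' hadd')
      right_inv := fun y => by
        have h1 : p ⟨transport (u y.1) (-δ) y.2.1, hmem y⟩ = y.1 :=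
          Subtype.ext (hbox y.1 y.2)
        have h2 := transport_neg_transport (hh y.1 y.2) hψ hsub'
        rw [neg_neg] at h2
        refine Prod.ext h1 (Subtype.ext ?_)
        simp only [h1]
        exact h2
      continuous_toFun := hp.prodMk (hc1.subtype_mk hbox')
      continuous_invFun := hc2.subtype_mk hmem }
  refine ⟨e, fun q g g' hgg => ?_⟩
  have hval : g'.1 = fun i => q * g.1 i * q⁻¹ := funext hgg
  have hpq : (p g' : S3) = q * (p g : S3) * q⁻¹ := by
    change box n g'.1 = q * box n g.1 * q⁻¹
    rw [hval, box_conj]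
  refine ⟨hpq, fun i => ?_⟩
  change transport (u (p g')) δ g'.1 i = q * transport (u (p g)) δ g.1 i * q⁻¹
  have huq : u (p g') = conjPure q (u (p g)) := axisOf_conj hsin q _ _ hpq
  rw [huq, hval, transport_conj]
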